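/- Let P be a 4-blocked point set and let S be a colour class of P. Suppose S contains a subset K of exactly four points in convex position (K is the vertex set of a convex quadrilateral conv(K)) such that conv(K) contains no point of S other than the four points of K. Then P is {4,2,2,1}-blocked. -/

import Mathlib

/-- `x` blocks `v` and `w` if `x` lies strictly between `v` and `w`. -/
def Blocks {E : Type*} [AddCommGroup E] [Module ℝ E] (x v w : E) : Prop :=
  x ∈ openSegment ℝ v w

/-- `v` and `w` are visible with respect to `P` if no point of `P` blocks them. -/
def Visible {E : Type*} [AddCommGroup E] [Module ℝ E] (P : Set E) (v w : E) : Prop :=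
  ∀ x ∈ P, ¬ Blocks x v w

/-- `c` is a blocked colouring of `P`: distinct points of `P` are visible
iff they get different colours. -/
def BlockedColouring {E : Type*} [AddCommGroup E] [Module ℝ E] {k : ℕ}
    (P : Set E) (c : E → Fin k) : Prop :=
  ∀ v ∈ P, ∀ w ∈ P, v ≠ w → (Visible P v w ↔ c v ≠ c w)

/-- `P` is `k`-blocked. -/
def KBlocked {E : Type*} [AddCommGroup E] [Module ℝ E] (k : ℕ) (P : Set E) : Prop :=
  P.Finite ∧ ∃ c : E → Fin k, BlockedColouring P c

/-- `P` is `{n₁,…,n_k}`-blocked where `N` is the multiset of colour class sizes. -/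
def IsNBlocked {E : Type*} [AddCommGroup E] [Module ℝ E] (N : Multiset ℕ) (P : Set E) : Prop :=
  P.Finite ∧ ∃ (k : ℕ) (c : E → Fin k), BlockedColouring P c ∧
    N = Finset.univ.val.map (fun i : Fin k => (P ∩ c ⁻¹' {i}).ncard)

/-- A multiset of positive integers is representable if some planar point set is
`N`-blocked. -/
def Representable (N : Multiset ℕ) : Prop :=
  ∃ P : Set (ℝ × ℝ), IsNBlocked N P

/-- A set is in convex position if no point lies in the convex hull of the others. -/
def ConvexPosition {E : Type*} [AddCommGroup E] [Module ℝ E] (K : Set E) : Prop :=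
  ∀ x ∈ K, x ∉ convexHull ℝ (K \ {x})

/-- `P` is `N`-midpoint-blocked: `N`-blocked, and midpoints of monochromatic pairs
belong to `P`. -/
def IsNMidpointBlocked {E : Type*} [AddCommGroup E] [Module ℝ E]
    (N : Multiset ℕ) (P : Set E) : Prop :=
  P.Finite ∧ ∃ (k : ℕ) (c : E → Fin k), BlockedColouring P c ∧
    (∀ v ∈ P, ∀ w ∈ P, v ≠ w → c v = c w → midpoint ℝ v w ∈ P) ∧
    N = Finset.univ.val.map (fun i : Fin k => (P ∩ c ⁻¹' {i}).ncard)

theorem mem_openSegment_iff_sbtw {E : Type*} [AddCommGroup E] [Module ℝ E] {u v z : E}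
    (huv : u ≠ v) : z ∈ openSegment ℝ u v ↔ Sbtw ℝ u z v := by
  constructor
  · intro h
    refine ⟨mem_segment_iff_wbtw.1 (openSegment_subset_segment ℝ u v h), ?_, ?_⟩
    · rintro rfl
      exact huv (left_mem_openSegment_iff.1 h)
    · rintro rfl
      exact huv (right_mem_openSegment_iff.1 h)
  · intro h
    exact mem_openSegment_of_ne_left_right h.left_ne h.right_ne (mem_segment_iff_wbtw.2 h.wbtw)

section Cross

/-- Twice the signed area of the triangle `u v w`. -/
def cross (u v w : ℝ × ℝ) : ℝ :=
  (v.1 - u.1) * (w.2 - u.2) - (v.2 - u.2) * (w.1 - u.1)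

theorem cross_rotate (u v w : ℝ × ℝ) : cross v w u = cross u v w := by
  unfold cross; ring

theorem cross_swap (u v w : ℝ × ℝ) : cross v u w = -cross u v w := by
  unfold cross; ring

@[simp] theorem cross_self_left (u v : ℝ × ℝ) : cross u v u = 0 := by
  unfold cross; ring

@[simp] theorem cross_self_right (u v : ℝ × ℝ) : cross u v v = 0 := by
  unfold cross; ring

theorem cross_add_smul (u v a b : ℝ × ℝ) {s t : ℝ} (h : s + t = 1) :
    cross u v (s • a + t • b) = s * cross u v a + t * cross u v b := by
  obtain rfl : t = 1 - s := by linarith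
  simp only [cross, Prod.fst_add, Prod.snd_add, Prod.smul_fst, Prod.smul_snd, smul_eq_mul]
  ring

theorem exists_cross_of_mem_openSegment {z a b : ℝ × ℝ} (h : z ∈ openSegment ℝ a b) :
    ∃ s t : ℝ, 0 < s ∧ 0 < t ∧ s + t = 1 ∧
      ∀ u v, cross u v z = s * cross u v a + t * cross u v b := by
  obtain ⟨s, t, hs, ht, hst, rfl⟩ := h
  exact ⟨s, t, hs, ht, hst, fun u v => cross_add_smul u v a b hst⟩

theorem cross_eq_zero_of_mem_openSegment {z a b : ℝ × ℝ} (h : z ∈ openSegment ℝ a b) :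
    cross a b z = 0 := by
  obtain ⟨s, t, -, -, -, H⟩ := exists_cross_of_mem_openSegment h
  simp [H]

theorem cross_eq_zero_of_mem_openSegment' {z a b : ℝ × ℝ} (h : z ∈ openSegment ℝ a b) :
    cross a z b = 0 := by
  rw [← cross_rotate, ← cross_rotate, cross_swap, cross_eq_zero_of_mem_openSegment h, neg_zero]

theorem cross_pos_of_mem_openSegment {u v z a b : ℝ × ℝ} (h : z ∈ openSegment ℝ a b)
    (ha : 0 ≤ cross u v a) (hb : 0 ≤ cross u v b) (hab : 0 < cross u v a ∨ 0 < cross u v b) :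
    0 < cross u v z := by
  obtain ⟨s, t, hs, ht, -, H⟩ := exists_cross_of_mem_openSegment h
  rw [H]
  rcases hab with h | h
  · have := mul_pos hs h; have := mul_nonneg ht.le hb; linarith
  · have := mul_pos ht h; have := mul_nonneg hs.le ha; linarith

theorem cross_neg_of_mem_openSegment {u v z a b : ℝ × ℝ} (h : z ∈ openSegment ℝ a b)
    (ha : cross u v a < 0) (hb : cross u v b ≤ 0) : cross u v z < 0 := by
  have := cross_pos_of_mem_openSegment (u := v) (v := u) h (by rw [cross_swap]; linarith)
    (by rw [cross_swap]; linarith) (Or.inl (by rw [cross_swap]; linarith))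
  rw [cross_swap] at this
  linarith

theorem cross_eq_zero_trans {u v w z : ℝ × ℝ} (huv : u ≠ v) (hw : cross u v w = 0)
    (hz : cross u v z = 0) : cross u w z = 0 := by
  unfold cross at *
  by_cases h1 : v.1 - u.1 = 0
  · have h2 : v.2 - u.2 ≠ 0 := fun h2 =>
      huv (Prod.ext (by linarith) (by linarith))
    apply mul_left_cancel₀ h2
    linear_combination (w.2 - u.2) * hz - (z.2 - u.2) * hw
  · apply mul_left_cancel₀ h1
    linear_combination (w.1 - u.1) * hz - (z.1 - u.1) * hw

theorem mem_openSegment_of_cross_eq_zero {u v w : ℝ × ℝ} (huv : u ≠ v) (huw : u ≠ w)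
    (hvw : v ≠ w) (h : cross u v w = 0) :
    w ∈ openSegment ℝ u v ∨ u ∈ openSegment ℝ v w ∨ v ∈ openSegment ℝ w u := by
  obtain ⟨t, rfl⟩ : ∃ t : ℝ, w = (1 - t) • u + t • v := by
    have hpos : 0 < (v.1 - u.1) ^ 2 + (v.2 - u.2) ^ 2 := by
      by_contra hn
      have h1 : v.1 - u.1 = 0 := by nlinarith [sq_nonneg (v.1 - u.1), sq_nonneg (v.2 - u.2)]
      have h2 : v.2 - u.2 = 0 := by nlinarith [sq_nonneg (v.1 - u.1), sq_nonneg (v.2 - u.2)]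
      exact huv (Prod.ext (by linarith) (by linarith))
    refine ⟨((v.1 - u.1) * (w.1 - u.1) + (v.2 - u.2) * (w.2 - u.2)) /
      ((v.1 - u.1) ^ 2 + (v.2 - u.2) ^ 2), ?_⟩
    unfold cross at h
    ext
    · simp only [Prod.fst_add, Prod.smul_fst, smul_eq_mul]
      field_simp
      linear_combination -(v.2 - u.2) * h
    · simp only [Prod.snd_add, Prod.smul_snd, smul_eq_mul]
      field_simp
      linear_combination (v.1 - u.1) * h
  have h0 : t ≠ 0 := by rintro rfl; simp at huw
  have h1 : t ≠ 1 := by rintro rfl; simp at hvw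
  rcases lt_or_gt_of_ne h0 with h0 | h0
  · refine Or.inr (Or.inl ⟨-t / (1 - t), 1 / (1 - t), ?_, ?_, ?_, ?_⟩)
    · exact div_pos (by linarith) (by linarith)
    · exact div_pos (by linarith) (by linarith)
    · have : 1 - t ≠ 0 := by linarith
      field_simp; ring
    · have : 1 - t ≠ 0 := by linarith
      ext <;> simp <;> field_simp <;> ring
  rcases lt_or_gt_of_ne h1 with h1 | h1
  · exact Or.inl ⟨1 - t, t, by linarith, h0, by ring, rfl⟩
  · refine Or.inr (Or.inr ⟨1 / t, (t - 1) / t, ?_, ?_, ?_, ?_⟩)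
    · exact div_pos (by linarith) (by linarith)
    · exact div_pos (by linarith) (by linarith)
    · field_simp; ring
    · ext <;> simp <;> field_simp <;> ring

theorem mem_convexHull_of_cross_nonneg {a b c w : ℝ × ℝ} (h : 0 < cross a b c)
    (h1 : 0 ≤ cross a b w) (h2 : 0 ≤ cross b c w) (h3 : 0 ≤ cross c a w) :
    w ∈ convexHull ℝ {a, b, c} := by
  have hsum : cross b c w + cross c a w + cross a b w = cross a b c := by unfold cross; ring
  have hw : w = ∑ j : Fin 3, ![cross b c w / cross a b c, cross c a w / cross a b c,
      cross a b w / cross a b c] j • ![a, b, c] j := by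
    simp only [Fin.sum_univ_three, Matrix.cons_val]
    unfold cross at *
    ext <;> simp only [Prod.fst_add, Prod.snd_add, Prod.smul_fst, Prod.smul_snd, smul_eq_mul] <;>
      field_simp <;> ring
  rw [hw]
  refine (convex_convexHull ℝ _).sum_mem ?_ ?_ ?_
  · intro j _
    fin_cases j
    exacts [div_nonneg h2 h.le, div_nonneg h3 h.le, div_nonneg h1 h.le]
  · simp only [Fin.sum_univ_three, Matrix.cons_val]
    rw [← add_div, ← add_div, hsum, div_self h.ne']
  · intro j _
    apply subset_convexHull
    fin_cases j <;> simp

theorem not_mem_openSegment_of_convexPosition {K : Set (ℝ × ℝ)} (hK : K.Finite)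
    (hconv : ConvexPosition K) {x u v : ℝ × ℝ} (hx : x ∈ K) (hu : u ∈ convexHull ℝ K)
    (hv : v ∈ convexHull ℝ K) (huv : u ≠ v) : x ∉ openSegment ℝ u v := by
  intro hxuv
  have hext : (convexHull ℝ K).extremePoints ℝ ⊆ K \ {x} := by
    refine fun y hy => ⟨extremePoints_convexHull_subset hy, ?_⟩
    rintro rfl
    rw [mem_extremePoints] at hy
    obtain ⟨h1, h2⟩ := hy.2 u hu v hv hxuv
    exact huv (h1.trans h2.symm)
  apply hconv x hx
  have hcl := closure_convexHull_extremePoints (hK.isCompact_convexHull (𝕜 := ℝ))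
    (convex_convexHull ℝ K)
  have hmem : x ∈ closure (convexHull ℝ ((convexHull ℝ K).extremePoints ℝ)) := by
    rw [hcl]; exact subset_convexHull ℝ K hx
  have := closure_mono (convexHull_mono hext) hmem
  rwa [(hK.sdiff.isClosed_convexHull (𝕜 := ℝ)).closure_eq] at this

end Cross

namespace BlockedColouring

section Basic

variable {k : ℕ} {P : Set (ℝ × ℝ)} {c : ℝ × ℝ → Fin k}

theorem eq_of_mem_openSegment (hc : BlockedColouring P c) {u v z : ℝ × ℝ} (hu : u ∈ P)
    (hv : v ∈ P) (hz : z ∈ P) (huv : u ≠ v) (h : z ∈ openSegment ℝ u v) : c u = c v := by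
  by_contra hne
  exact ((hc u hu v hv huv).2 hne) z hz h

theorem exists_blocker (hc : BlockedColouring P c) {u v : ℝ × ℝ} (hu : u ∈ P)
    (hv : v ∈ P) (huv : u ≠ v) (h : c u = c v) : ∃ z ∈ P, z ∈ openSegment ℝ u v := by
  by_contra! hne
  exact (hc u hu v hv huv).1 hne h

theorem restrict (hc : BlockedColouring P c) {Q : Set (ℝ × ℝ)} (hQP : Q ⊆ P)
    (hQ : ∀ u ∈ Q, ∀ v ∈ Q, u ≠ v → ∀ z ∈ P, z ∈ openSegment ℝ u v → z ∈ Q) :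
    BlockedColouring Q c := by
  intro u hu v hv huv
  rw [← hc u (hQP hu) v (hQP hv) huv]
  exact ⟨fun h z hz hzuv => h z (hQ u hu v hv huv z hz hzuv) hzuv,
    fun h z hz hzuv => h z (hQP hz) hzuv⟩

theorem ne_of_mem_openSegment (hc : BlockedColouring P c) (hP : P.Finite) {u v z : ℝ × ℝ}
    (hu : u ∈ P) (hv : v ∈ P) (hz : z ∈ P) (huv : u ≠ v) (h : z ∈ openSegment ℝ u v) :
    c z ≠ c u := by
  induction hn : (P ∩ openSegment ℝ u v).ncard using Nat.strong_induction_on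
    generalizing v z with
  | _ n ih =>
    intro hzu
    have hs : Sbtw ℝ u z v := (mem_openSegment_iff_sbtw huv).1 h
    have huz := hs.left_ne
    obtain ⟨y, hy, hyz⟩ := hc.exists_blocker hu hz huz hzu.symm
    have hs' : Sbtw ℝ u y z := (mem_openSegment_iff_sbtw huz).1 hyz
    have hyv : y ≠ v := (hs.trans_left hs').ne_right
    have hzyv := (mem_openSegment_iff_sbtw hyv).2 (hs.trans_left_right hs')
    have hyu : c y = c u := (hc.eq_of_mem_openSegment hy hv hz hyv hzyv).trans
      (hc.eq_of_mem_openSegment hu hv hz huv h).symm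
    refine ih (P ∩ openSegment ℝ u z).ncard ?_ hz hy huz hyz rfl hyu
    rw [← hn]
    refine Set.ncard_lt_ncard ?_ (hP.inter_of_left _)
    refine Set.ssubset_iff_of_subset ?_ |>.2 ⟨z, ⟨hz, h⟩, ?_⟩
    · rintro w ⟨hw, hwz⟩
      exact ⟨hw, (mem_openSegment_iff_sbtw huv).2
        (hs.trans_left ((mem_openSegment_iff_sbtw huz).1 hwz))⟩
    · rintro ⟨-, hzz⟩
      exact huz (right_mem_openSegment_iff.1 hzz)

theorem cross_ne_zero (hc : BlockedColouring P c) (hP : P.Finite) {u v w : ℝ × ℝ}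
    (hu : u ∈ P) (hv : v ∈ P) (hw : w ∈ P) (huv : u ≠ v) (huw : u ≠ w) (hvw : v ≠ w)
    (h1 : c u = c v) (h2 : c u = c w) : cross u v w ≠ 0 := by
  intro h
  rcases mem_openSegment_of_cross_eq_zero huv huw hvw h with h | h | h
  · exact hc.ne_of_mem_openSegment hP hu hv hw huv h h2.symm
  · exact hc.ne_of_mem_openSegment hP hv hw hu hvw h h1
  · exact hc.ne_of_mem_openSegment hP hw hu hv huw.symm h (h1.symm.trans h2)

theorem collinear_cases (hc : BlockedColouring P c) (hP : P.Finite) {u v w : ℝ × ℝ}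
    (hu : u ∈ P) (hv : v ∈ P) (hw : w ∈ P) (huv : u ≠ v) (huw : u ≠ w) (hvw : v ≠ w)
    (h : cross u v w = 0) :
    (w ∈ openSegment ℝ u v ∧ c u = c v ∧ c w ≠ c u) ∨
    (u ∈ openSegment ℝ v w ∧ c v = c w ∧ c u ≠ c v) ∨
    (v ∈ openSegment ℝ w u ∧ c w = c u ∧ c v ≠ c w) := by
  rcases mem_openSegment_of_cross_eq_zero huv huw hvw h with h | h | h
  · exact Or.inl ⟨h, hc.eq_of_mem_openSegment hu hv hw huv h,
      hc.ne_of_mem_openSegment hP hu hv hw huv h⟩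
  · exact Or.inr (Or.inl ⟨h, hc.eq_of_mem_openSegment hv hw hu hvw h,
      hc.ne_of_mem_openSegment hP hv hw hu hvw h⟩)
  · exact Or.inr (Or.inr ⟨h, hc.eq_of_mem_openSegment hw hu hv huw.symm h,
      hc.ne_of_mem_openSegment hP hw hu hv huw.symm h⟩)

/-- No four points of a blocked set are collinear. -/
theorem not_four_collinear (hc : BlockedColouring P c) (hP : P.Finite) {u v w z : ℝ × ℝ}
    (hu : u ∈ P) (hv : v ∈ P) (hw : w ∈ P) (hz : z ∈ P) (huv : u ≠ v) (huw : u ≠ w)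
    (huz : u ≠ z) (hvw : v ≠ w) (hvz : v ≠ z) (hwz : w ≠ z) (h1 : cross u v w = 0)
    (h2 : cross u v z = 0) : False := by
  have h3 := cross_eq_zero_trans huv h1 h2
  have h4 : cross v w z = 0 := cross_eq_zero_trans huv.symm
    (by rw [cross_swap, h1, neg_zero]) (by rw [cross_swap, h2, neg_zero])
  have key : ∀ a b x y : ℝ × ℝ, a ≠ b → x ∈ openSegment ℝ a b → y ∈ openSegment ℝ a b →
      a ∉ openSegment ℝ x y := by
    intro a b x y hab hx hy ha
    have := (convex_openSegment a b).openSegment_subset hx hy ha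
    exact hab (left_mem_openSegment_iff.1 this)
  have symm : ∀ a b x : ℝ × ℝ, x ∈ openSegment ℝ a b → x ∈ openSegment ℝ b a := by
    intro a b x hx
    rwa [openSegment_symm]
  have c1 := hc.collinear_cases hP hu hv hw huv huw hvw h1
  have c2 := hc.collinear_cases hP hu hv hz huv huz hvz h2
  have c3 := hc.collinear_cases hP hu hw hz huw huz hwz h3
  have c4 := hc.collinear_cases hP hv hw hz hvw hvz hwz h4
  rcases c1 with c1 | c1 | c1 <;> rcases c2 with c2 | c2 | c2 <;>
    rcases c3 with c3 | c3 | c3 <;> rcases c4 with c4 | c4 | c4 <;> grind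

theorem cross_ne_zero_of_blocker (hc : BlockedColouring P c) (hP : P.Finite)
    {u v z e : ℝ × ℝ} (hu : u ∈ P) (hv : v ∈ P) (hz : z ∈ P) (he : e ∈ P) (huv : u ≠ v)
    (hue : u ≠ e) (hve : v ≠ e) (hze : z ≠ e) (h : z ∈ openSegment ℝ u v) :
    cross u v e ≠ 0 := by
  have hs := (mem_openSegment_iff_sbtw huv).1 h
  exact hc.not_four_collinear hP hu hv hz he huv hs.left_ne hue hs.right_ne hve hze
    (cross_eq_zero_of_mem_openSegment h)

end Basic

section ThreeColours

variable {Q : Set (ℝ × ℝ)} {c : ℝ × ℝ → Fin 4} {i : Fin 4}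

/-- A monochromatic triangle of least area in a set avoiding one of four colours cannot have
two of its side blockers of the same colour. -/
theorem blocker_ne_of_minimal (hc : BlockedColouring Q c) (hQ : Q.Finite)
    (hi : ∀ z ∈ Q, c z ≠ i) {u v w : ℝ × ℝ} (hu : u ∈ Q) (hv : v ∈ Q) (hw : w ∈ Q)
    (huv : u ≠ v) (huw : u ≠ w) (hvw : v ≠ w) (cuv : c u = c v) (cuw : c u = c w)
    (hmin : ∀ u' ∈ Q, ∀ v' ∈ Q, ∀ w' ∈ Q, u' ≠ v' → u' ≠ w' → v' ≠ w' → c u' = c v' →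
      c u' = c w' → |cross u v w| ≤ |cross u' v' w'|)
    {x y z : ℝ × ℝ} (hx : x ∈ Q) (hy : y ∈ Q) (hz : z ∈ Q) (hxvw : x ∈ openSegment ℝ v w)
    (hywu : y ∈ openSegment ℝ w u) (hzuv : z ∈ openSegment ℝ u v) : c x ≠ c y := by
  intro cxy
  have hA : cross u v w ≠ 0 := hc.cross_ne_zero hQ hu hv hw huv huw hvw cuv cuw
  have hshrink : ∀ u' ∈ Q, ∀ v' ∈ Q, ∀ w' ∈ Q, u' ≠ v' → u' ≠ w' → v' ≠ w' → c u' = c v' →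
      c u' = c w' → ∀ r : ℝ, 0 ≤ r → r < 1 → cross u' v' w' ≠ r * cross u v w := by
    intro u' hu' v' hv' w' hw' h1 h2 h3 h4 h5 r hr hr1 h
    have := hmin u' hu' v' hv' w' hw' h1 h2 h3 h4 h5
    rw [h, abs_mul, abs_of_nonneg hr] at this
    nlinarith [abs_pos.2 hA]
  have cx := hc.ne_of_mem_openSegment hQ hv hw hx hvw hxvw
  have cy := hc.ne_of_mem_openSegment hQ hw hu hy huw.symm hywu
  have cz := hc.ne_of_mem_openSegment hQ hu hv hz huv hzuv
  obtain ⟨a₁, b₁, ha₁, hb₁, hab₁, X⟩ := exists_cross_of_mem_openSegment hxvw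
  obtain ⟨a₂, b₂, ha₂, hb₂, hab₂, Y⟩ := exists_cross_of_mem_openSegment hywu
  obtain ⟨a₃, b₃, ha₃, hb₃, hab₃, Z⟩ := exists_cross_of_mem_openSegment hzuv
  have Xuv : cross u v x = b₁ * cross u v w := by simp [X]
  have Yuv : cross u v y = a₂ * cross u v w := by simp [Y]
  have Zuv : cross u v z = 0 := by simp [Z]
  have hXpos : cross u v x ≠ 0 := by rw [Xuv]; positivity
  have hYpos : cross u v y ≠ 0 := by rw [Yuv]; positivity
  have hzx : z ≠ x := by rintro rfl; exact hXpos Zuv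
  have hzy : z ≠ y := by rintro rfl; exact hYpos Zuv
  have hxy : x ≠ y := by
    rintro rfl
    have h1 : cross v w x = 0 := by simp [X]
    have h2 : cross v w x = b₂ * cross u v w := by simp [Y, cross_rotate]
    rw [h1] at h2
    exact (mul_ne_zero hb₂.ne' hA) h2.symm
  have hxyz : cross x y z = (a₁ * a₂ * a₃ + b₁ * b₂ * b₃) * cross u v w := by
    have e1 : cross x y u = a₁ * a₂ * cross u v w := by
      rw [cross_rotate u x y, Y u x, ← cross_rotate u x w, ← cross_rotate x w u, X w u,
        ← cross_rotate w u v]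
      simp only [cross_self_left]
      ring
    have e2 : cross x y v = b₁ * b₂ * cross u v w := by
      rw [cross_rotate v x y, Y v x, ← cross_rotate v x w, ← cross_rotate x w v, X w v,
        ← cross_rotate v x u, ← cross_rotate x u v, Xuv]
      simp only [cross_self_left, cross_self_right]
      ring
    rw [Z, e1, e2]
    ring
  have hr1 : a₁ * a₂ * a₃ + b₁ * b₂ * b₃ < 1 := by
    have h1 : a₁ * a₂ < 1 := mul_lt_one_of_nonneg_of_lt_one_left ha₁.le (by linarith) (by linarith)
    have h2 : b₁ * b₂ < 1 := mul_lt_one_of_nonneg_of_lt_one_left hb₁.le (by linarith) (by linarith)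
    nlinarith
  have czx : c z ≠ c x := by
    intro czx
    refine hshrink x hx y hy z hz hxy hzx.symm hzy.symm cxy czx.symm _ ?_ ?_ hxyz
    · positivity
    · exact hr1
  obtain ⟨t, ht, htxy⟩ := hc.exists_blocker hx hy hxy cxy
  have ctx := hc.ne_of_mem_openSegment hQ hx hy ht hxy htxy
  obtain ⟨a₄, b₄, ha₄, hb₄, hab₄, T⟩ := exists_cross_of_mem_openSegment htxy
  have Tuv : cross u v t = (a₄ * b₁ + b₄ * a₂) * cross u v w := by
    rw [T, Xuv, Yuv]; ring
  have hk1 : a₄ * b₁ + b₄ * a₂ < 1 := by nlinarith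
  have ctu : c t ≠ c u := by
    intro ctu
    have hk : cross u v t ≠ 0 := by rw [Tuv]; positivity
    refine hshrink u hu v hv t ht huv ?_ ?_ cuv ctu.symm _ ?_ ?_ Tuv
    · rintro rfl; simp at hk
    · rintro rfl; simp at hk
    · positivity
    · exact hk1
  have ctz : c t = c z := by
    have := hi t ht; have := hi z hz; have := hi u hu; have := hi x hx
    grind
  have htz : t ≠ z := by
    rintro rfl
    have h0 := cross_eq_zero_of_mem_openSegment htxy
    rw [hxyz] at h0
    exact (mul_ne_zero (by positivity) hA) h0
  obtain ⟨s, hs, hstz⟩ := hc.exists_blocker ht hz htz ctz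
  have cst := hc.ne_of_mem_openSegment hQ ht hz hs htz hstz
  obtain ⟨a₅, b₅, ha₅, hb₅, hab₅, S⟩ := exists_cross_of_mem_openSegment hstz
  have Suv : cross u v s = (a₅ * (a₄ * b₁ + b₄ * a₂)) * cross u v w := by
    rw [S, Tuv, Zuv]; ring
  have csu : c s ≠ c u := by
    intro csu
    have hk : cross u v s ≠ 0 := by rw [Suv]; positivity
    refine hshrink u hu v hv s hs huv ?_ ?_ cuv csu.symm _ ?_ ?_ Suv
    · rintro rfl; simp at hk
    · rintro rfl; simp at hk
    · positivity
    · exact mul_lt_one_of_nonneg_of_lt_one_left ha₅.le (by linarith) hk1.le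
  have csx : c s = c x := by
    have := hi s hs; have := hi z hz; have := hi u hu; have := hi x hx
    grind
  have hS : cross x y s = (b₅ * (a₁ * a₂ * a₃ + b₁ * b₂ * b₃)) * cross u v w := by
    rw [S, T, hxyz]
    simp
    ring
  have hk : cross x y s ≠ 0 := by rw [hS]; positivity
  refine hshrink x hx y hy s hs hxy ?_ ?_ cxy csx.symm _ ?_ ?_ hS
  · rintro rfl; simp at hk
  · rintro rfl; simp at hk
  · positivity
  · exact mul_lt_one_of_nonneg_of_lt_one_left hb₅.le (by linarith) hr1.le

theorem not_three_monochromatic (hc : BlockedColouring Q c) (hQ : Q.Finite)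
    (hi : ∀ z ∈ Q, c z ≠ i) {u v w : ℝ × ℝ} (hu : u ∈ Q) (hv : v ∈ Q) (hw : w ∈ Q)
    (huv : u ≠ v) (huw : u ≠ w) (hvw : v ≠ w) (cuv : c u = c v) : c u ≠ c w := by
  intro cuw
  let T : Set ((ℝ × ℝ) × (ℝ × ℝ) × (ℝ × ℝ)) :=
    {t | t ∈ Q ×ˢ Q ×ˢ Q ∧ t.1 ≠ t.2.1 ∧ t.1 ≠ t.2.2 ∧ t.2.1 ≠ t.2.2 ∧ c t.1 = c t.2.1 ∧
      c t.1 = c t.2.2}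
  have hT : T.Finite := (hQ.prod (hQ.prod hQ)).subset fun t ht => ht.1
  obtain ⟨⟨u, v, w⟩, ⟨⟨hu, hv, hw⟩, huv, huw, hvw, cuv, cuw⟩, hmin⟩ :=
    T.exists_min_image (fun t => |cross t.1 t.2.1 t.2.2|) hT
      ⟨(u, v, w), ⟨hu, hv, hw⟩, huv, huw, hvw, cuv, cuw⟩
  dsimp only at *
  replace hmin : ∀ u' ∈ Q, ∀ v' ∈ Q, ∀ w' ∈ Q, u' ≠ v' → u' ≠ w' → v' ≠ w' → c u' = c v' →
      c u' = c w' → |cross u v w| ≤ |cross u' v' w'| :=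
    fun u' hu' v' hv' w' hw' h1 h2 h3 h4 h5 =>
      hmin (u', v', w') ⟨⟨hu', hv', hw'⟩, h1, h2, h3, h4, h5⟩
  obtain ⟨x, hx, hxvw⟩ := hc.exists_blocker hv hw hvw (cuv.symm.trans cuw)
  obtain ⟨y, hy, hywu⟩ := hc.exists_blocker hw hu huw.symm cuw.symm
  obtain ⟨z, hz, hzuv⟩ := hc.exists_blocker hu hv huv cuv
  have cx := hc.ne_of_mem_openSegment hQ hv hw hx hvw hxvw
  have cy := hc.ne_of_mem_openSegment hQ hw hu hy huw.symm hywu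
  have cz := hc.ne_of_mem_openSegment hQ hu hv hz huv hzuv
  have h1 := hc.blocker_ne_of_minimal hQ hi hu hv hw huv huw hvw cuv cuw hmin hx hy hz hxvw hywu
    hzuv
  have h2 := hc.blocker_ne_of_minimal hQ hi hv hw hu hvw huv.symm huw.symm
    (cuv.symm.trans cuw) cuv.symm (by rwa [cross_rotate]) hy hz hx hywu hzuv hxvw
  have h3 := hc.blocker_ne_of_minimal hQ hi hw hu hv huw.symm hvw.symm huv
    cuw.symm (cuw.symm.trans cuv) (by rwa [← cross_rotate w u v]) hz hx hy hzuv hxvw hywu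
  have := hi u hu; have := hi x hx; have := hi y hy; have := hi z hz
  grind

theorem length_le_of_nodup (hc : BlockedColouring Q c) (hQ : Q.Finite)
    (hi : ∀ z ∈ Q, c z ≠ i) {l : List (ℝ × ℝ)} (hl : l.Nodup) (hlQ : ∀ z ∈ l, z ∈ Q)
    {C : Finset (Fin 4)} (hC : ∀ z ∈ l, c z ∈ C) : l.length ≤ 2 * C.card := by
  rw [← List.toFinset_card_of_nodup hl]
  refine Finset.card_le_mul_card_image_of_maps_to (f := c) (by simpa using hC) 2 fun b _ => ?_
  by_contra! h
  obtain ⟨u, v, w, hu, hv, hw, huv, huw, hvw⟩ := Finset.two_lt_card_iff.1 h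
  simp only [Finset.mem_filter, List.mem_toFinset] at hu hv hw
  exact hc.not_three_monochromatic hQ hi (hlQ u hu.1) (hlQ v hv.1) (hlQ w hw.1) huv huw hvw
    (hu.2.trans hv.2.symm) (hu.2.trans hw.2.symm)

end ThreeColours

end BlockedColouring

section Quadrilateral

/-- A four-point set in convex position can be listed in counterclockwise order. -/
theorem exists_counterclockwise {K : Set (ℝ × ℝ)} (hK4 : K.ncard = 4)
    (hK : ConvexPosition K) : ∃ A B C D, K = {A, B, C, D} ∧ 0 < cross A B C ∧
      0 < cross B C D ∧ 0 < cross C D A ∧ 0 < cross D A B := by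
  have hne : ∀ u ∈ K, ∀ v ∈ K, ∀ w ∈ K, u ≠ v → u ≠ w → v ≠ w → cross u v w ≠ 0 := by
    have key : ∀ u ∈ K, ∀ v ∈ K, ∀ w ∈ K, u ≠ w → v ≠ w → w ∉ openSegment ℝ u v := by
      intro u hu v hv w hw huw hvw h
      exact hK w hw ((convex_convexHull ℝ _).openSegment_subset
        (subset_convexHull ℝ (K \ {w}) ⟨hu, huw⟩) (subset_convexHull ℝ (K \ {w}) ⟨hv, hvw⟩) h)
    intro u hu v hv w hw huv huw hvw h
    rcases mem_openSegment_of_cross_eq_zero huv huw hvw h with h | h | h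
    · exact key u hu v hv w hw huw hvw h
    · exact key v hv w hw u hu huv.symm huw.symm h
    · exact key w hw u hu v hv hvw.symm huv h
  have hin : ∀ u ∈ K, ∀ v ∈ K, ∀ w ∈ K, ∀ z ∈ K, u ≠ z → v ≠ z → w ≠ z → 0 < cross u v w →
      0 < cross u v z → 0 < cross v w z → 0 < cross w u z → False := by
    intro u hu v hv w hw z hz huz hvz hwz h h1 h2 h3
    refine hK z hz (convexHull_mono ?_ (mem_convexHull_of_cross_nonneg h h1.le h2.le h3.le))
    rintro t (rfl | rfl | rfl)
    exacts [⟨hu, huz⟩, ⟨hv, hvz⟩, ⟨hw, hwz⟩]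
  obtain ⟨a, b, c, d, hab, hac, had, hbc, hbd, hcd, rfl, habc⟩ : ∃ a b c d : ℝ × ℝ,
      a ≠ b ∧ a ≠ c ∧ a ≠ d ∧ b ≠ c ∧ b ≠ d ∧ c ≠ d ∧ K = {a, b, c, d} ∧
        0 < cross a b c := by
    have hfin : K.Finite := Set.finite_of_ncard_ne_zero (by omega)
    rw [Set.ncard_eq_toFinset_card K hfin, Finset.card_eq_four] at hK4
    obtain ⟨a, b, c, d, hab, hac, had, hbc, hbd, hcd, hE⟩ := hK4
    have hKe : K = {a, b, c, d} := by
      rw [← hfin.coe_toFinset, hE]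
      simp
    have h0 := hne a (by simp [hKe]) b (by simp [hKe]) c (by simp [hKe]) hab hac hbc
    rcases lt_or_gt_of_ne h0 with h0 | h0
    · refine ⟨b, a, c, d, hab.symm, hbc, hbd, hac, had, hcd, ?_, by rw [cross_swap]; linarith⟩
      rw [hKe, Set.insert_comm]
    · exact ⟨a, b, c, d, hab, hac, had, hbc, hbd, hcd, hKe, h0⟩
  have ha : a ∈ ({a, b, c, d} : Set (ℝ × ℝ)) := by simp
  have hb : b ∈ ({a, b, c, d} : Set (ℝ × ℝ)) := by simp
  have hc : c ∈ ({a, b, c, d} : Set (ℝ × ℝ)) := by simp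
  have hd : d ∈ ({a, b, c, d} : Set (ℝ × ℝ)) := by simp
  have i1 := hin a ha b hb c hc d hd had hbd hcd
  have i2 := hin a ha d hd c hc b hb hab hbd.symm hbc.symm
  have i3 := hin a ha b hb d hd c hc hac hbc hcd.symm
  have i4 := hin b hb c hc d hd a ha hab.symm hac.symm had.symm
  have hsum : cross a b d + cross b c d + cross c a d = cross a b c := by unfold cross; ring
  have n1 := hne a ha b hb d hd hab had hbd
  have n2 := hne b hb c hc d hd hbc hbd hcd
  have n3 := hne c hc a ha d hd hac.symm hcd had
  have r1 : cross b c a = cross a b c := cross_rotate a b c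
  have r2 : cross c a b = cross a b c := (cross_rotate c a b).symm
  have r3 : cross a d b = -cross a b d := by unfold cross; ring
  have r4 : cross d b a = -cross a b d := by unfold cross; ring
  have r5 : cross d a b = cross a b d := by unfold cross; ring
  have r6 : cross d b c = cross b c d := by unfold cross; ring
  have r7 : cross b d c = -cross b c d := by unfold cross; ring
  have r8 : cross d c b = -cross b c d := by unfold cross; ring
  have r9 : cross d c a = cross c a d := by unfold cross; ring
  have r10 : cross a d c = cross c a d := by unfold cross; ring
  have r11 : cross d a c = -cross c a d := by unfold cross; ring
  have r12 : cross c d a = -cross c a d := by unfold cross; ring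
  rw [r10, r3, r8, r2] at i2
  rw [r7, r11] at i3
  rw [r1, r12, r4] at i4
  rcases lt_or_gt_of_ne n1 with n1 | n1 <;> rcases lt_or_gt_of_ne n2 with n2 | n2 <;>
    rcases lt_or_gt_of_ne n3 with n3 | n3
  · linarith
  · exact (i2 n3 (by linarith) (by linarith) habc).elim
  · exact (i4 n2 habc (by linarith) (by linarith)).elim
  · refine ⟨a, d, b, c, ?_, by linarith, by linarith, by linarith, by linarith⟩
    rw [Set.pair_comm c d, Set.insert_comm b d]
  · exact (i3 n1 habc (by linarith) (by linarith)).elim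
  · refine ⟨a, b, d, c, ?_, by linarith, by linarith, by linarith, by linarith⟩
    rw [Set.pair_comm c d]
  · exact ⟨a, b, c, d, rfl, by linarith, by linarith, by linarith, by linarith⟩
  · exact (i1 habc n1 n2 n3).elim

/-- The intersection of the half-planes to the left of the sides of `A B C D`. -/
def quadRegion (A B C D : ℝ × ℝ) : Set (ℝ × ℝ) :=
  {z | 0 ≤ cross A B z ∧ 0 ≤ cross B C z ∧ 0 ≤ cross C D z ∧ 0 ≤ cross D A z}

theorem convex_quadRegion (A B C D : ℝ × ℝ) : Convex ℝ (quadRegion A B C D) := by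
  rintro u ⟨hu1, hu2, hu3, hu4⟩ v ⟨hv1, hv2, hv3, hv4⟩ s t hs ht hst
  refine ⟨?_, ?_, ?_, ?_⟩ <;> rw [cross_add_smul _ _ _ _ hst] <;> positivity

theorem quadRegion_rotate (A B C D : ℝ × ℝ) : quadRegion B C D A = quadRegion A B C D := by
  ext z
  simp only [quadRegion, Set.mem_ofPred_eq]
  tauto

variable {A B C D p q x : ℝ × ℝ}

theorem quadRegion_subset_convexHull (hABC : 0 < cross A B C) (hCDA : 0 < cross C D A) :
    quadRegion A B C D ⊆ convexHull ℝ {A, B, C, D} := by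
  rintro z ⟨h1, h2, h3, h4⟩
  rcases le_total 0 (cross C A z) with h | h
  · refine convexHull_mono ?_ (mem_convexHull_of_cross_nonneg hABC h1 h2 h)
    intro t; simp; tauto
  · refine convexHull_mono ?_ (mem_convexHull_of_cross_nonneg hCDA h3 h4
      (by rw [cross_swap]; linarith))
    intro t; simp; tauto

theorem vertices_subset_quadRegion (hABC : 0 < cross A B C) (hBCD : 0 < cross B C D)
    (hCDA : 0 < cross C D A) (hDAB : 0 < cross D A B) : {A, B, C, D} ⊆ quadRegion A B C D := by
  have h1 := cross_rotate A B C
  have h2 := cross_rotate B C D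
  have h3 := cross_rotate C D A
  have h4 := cross_rotate D A B
  rintro z (rfl | rfl | rfl | rfl) <;> refine ⟨?_, ?_, ?_, ?_⟩ <;>
    grind [cross_self_left, cross_self_right]

theorem cross_of_mem_side (hABC : 0 < cross A B C) (hBCD : 0 < cross B C D)
    (hCDA : 0 < cross C D A) (hDAB : 0 < cross D A B) (hp : p ∈ openSegment ℝ A B) :
    cross A B p = 0 ∧ 0 < cross B C p ∧ 0 < cross C D p ∧ 0 < cross D A p := by
  have h1 := cross_rotate A B C
  have h2 := cross_rotate B C D
  refine ⟨cross_eq_zero_of_mem_openSegment hp, cross_pos_of_mem_openSegment hp ?_ ?_ ?_,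
    cross_pos_of_mem_openSegment hp ?_ ?_ ?_, cross_pos_of_mem_openSegment hp ?_ ?_ ?_⟩ <;>
    grind [cross_self_left, cross_self_right]

theorem cross_pos_of_mem_diagonal (hABC : 0 < cross A B C) (hCDA : 0 < cross C D A)
    (hx : x ∈ openSegment ℝ A C) :
    0 < cross A B x ∧ 0 < cross B C x ∧ 0 < cross C D x ∧ 0 < cross D A x := by
  have h1 := cross_rotate A B C
  have h2 := cross_rotate C D A
  refine ⟨cross_pos_of_mem_openSegment hx ?_ ?_ ?_, cross_pos_of_mem_openSegment hx ?_ ?_ ?_,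
    cross_pos_of_mem_openSegment hx ?_ ?_ ?_, cross_pos_of_mem_openSegment hx ?_ ?_ ?_⟩ <;>
    grind [cross_self_left, cross_self_right]

theorem diagonal_not_mem_openSegment (hABC : 0 < cross A B C) (hp : p ∈ openSegment ℝ A B)
    (hq : q ∈ openSegment ℝ B C) (hx : x ∈ openSegment ℝ A C) : x ∉ openSegment ℝ p q := by
  intro h
  have hB : 0 < cross C A B := by rwa [← cross_rotate C A B]
  have h1 : 0 < cross C A p := cross_pos_of_mem_openSegment hp (by simp) hB.le (Or.inr hB)
  have h2 : 0 < cross C A q := cross_pos_of_mem_openSegment hq hB.le (by simp) (Or.inl hB)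
  have h3 := cross_pos_of_mem_openSegment h h1.le h2.le (Or.inl h1)
  rw [openSegment_symm] at hx
  rw [cross_eq_zero_of_mem_openSegment hx] at h3
  exact lt_irrefl _ h3

section BlockedQuad

/-- A counterclockwise quadrilateral `A B C D` of one colour in `P`, together with the
blockers `p q r s` of its sides and the common blocker `x` of its diagonals, which are all the
points of `P` in the quadrilateral. -/
structure BlockedQuad (P : Set (ℝ × ℝ)) (c : ℝ × ℝ → Fin 4)
    (A B C D p q r s x : ℝ × ℝ) : Prop where
  subset : {A, B, C, D, p, q, r, s, x} ⊆ P
  crossA : 0 < cross A B C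
  crossB : 0 < cross B C D
  crossC : 0 < cross C D A
  crossD : 0 < cross D A B
  memp : p ∈ openSegment ℝ A B
  memq : q ∈ openSegment ℝ B C
  memr : r ∈ openSegment ℝ C D
  mems : s ∈ openSegment ℝ D A
  memAC : x ∈ openSegment ℝ A C
  memBD : x ∈ openSegment ℝ B D
  mempr : x ∈ openSegment ℝ p r
  memqs : x ∈ openSegment ℝ q s
  inside : P ∩ quadRegion A B C D ⊆ {A, B, C, D, p, q, r, s, x}
  colAB : c A = c B
  colBC : c B = c C
  colCD : c C = c D
  colpr : c p = c r
  colqs : c q = c s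
  colAp : c A ≠ c p
  colAq : c A ≠ c q
  colAx : c A ≠ c x
  colpq : c p ≠ c q
  colpx : c p ≠ c x
  colqx : c q ≠ c x

theorem exists_blockedQuad {P : Set (ℝ × ℝ)} (hP : P.Finite) {c : ℝ × ℝ → Fin 4}
    (hc : BlockedColouring P c) {i : Fin 4} {K : Set (ℝ × ℝ)} (hKS : K ⊆ P ∩ c ⁻¹' {i})
    (hK4 : K.ncard = 4) (hK : ConvexPosition K)
    (hempty : (P ∩ c ⁻¹' {i}) ∩ convexHull ℝ K ⊆ K) :
    ∃ A B C D p q r s x, K = {A, B, C, D} ∧ BlockedQuad P c A B C D p q r s x := by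
  obtain ⟨A, B, C, D, hKe, hABC, hBCD, hCDA, hDAB⟩ := exists_counterclockwise hK4 hK
  have hA : A ∈ K := by simp [hKe]
  have hB : B ∈ K := by simp [hKe]
  have hC : C ∈ K := by simp [hKe]
  have hD : D ∈ K := by simp [hKe]
  have hKfin : K.Finite := hP.subset fun z hz => (hKS hz).1
  have hKP : ∀ z ∈ K, z ∈ P := fun z hz => (hKS hz).1
  have hKc : ∀ z ∈ K, c z = i := fun z hz => (hKS hz).2
  have hAB : A ≠ B := by rintro rfl; simp [cross] at hABC
  have hBC : B ≠ C := by rintro rfl; simp [cross] at hBCD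
  have hCD : C ≠ D := by rintro rfl; simp [cross] at hCDA
  have hDA : D ≠ A := by rintro rfl; simp [cross] at hDAB
  have hAC : A ≠ C := by rintro rfl; simp [cross] at hABC
  have hBD : B ≠ D := by rintro rfl; simp [cross] at hBCD
  set R := quadRegion A B C D
  have hRconv : Convex ℝ R := convex_quadRegion A B C D
  have hRK : R ⊆ convexHull ℝ K := hKe ▸ quadRegion_subset_convexHull hABC hCDA
  have hKR : K ⊆ R := by
    rw [hKe]
    exact vertices_subset_quadRegion hABC hBCD hCDA hDAB
  let Q : Set (ℝ × ℝ) := {z | z ∈ P ∧ z ∈ R ∧ c z ≠ i}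
  have hQP : Q ⊆ P := fun z hz => hz.1
  have hQ : Q.Finite := hP.subset hQP
  have hi : ∀ z ∈ Q, c z ≠ i := fun z hz => hz.2.2
  have hcQ : BlockedColouring Q c := by
    refine hc.restrict hQP fun u hu v hv huv z hz hzuv => ?_
    have hzR := hRconv.openSegment_subset hu.2.1 hv.2.1 hzuv
    exact ⟨hz, hzR, fun hzi => not_mem_openSegment_of_convexPosition hKfin hK
      (hempty ⟨⟨hz, hzi⟩, hRK hzR⟩) (hRK hu.2.1) (hRK hv.2.1) huv hzuv⟩
  have hblock : ∀ u ∈ K, ∀ v ∈ K, u ≠ v → ∃ z ∈ Q, z ∈ openSegment ℝ u v := by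
    intro u hu v hv huv
    obtain ⟨z, hz, hzuv⟩ := hc.exists_blocker (hKP u hu) (hKP v hv) huv
      ((hKc u hu).trans (hKc v hv).symm)
    refine ⟨z, ⟨hz, hRconv.openSegment_subset (hKR hu) (hKR hv) hzuv, ?_⟩, hzuv⟩
    rw [← hKc u hu]
    exact hc.ne_of_mem_openSegment hP (hKP u hu) (hKP v hv) hz huv hzuv
  obtain ⟨p, hp, hpm⟩ := hblock A hA B hB hAB
  obtain ⟨q, hq, hqm⟩ := hblock B hB C hC hBC
  obtain ⟨r, hr, hrm⟩ := hblock C hC D hD hCD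
  obtain ⟨s, hs, hsm⟩ := hblock D hD A hA hDA
  obtain ⟨x, hx, hxm⟩ := hblock A hA C hC hAC
  obtain ⟨y, hy, hym⟩ := hblock B hB D hD hBD
  obtain ⟨p1, p2, p3, p4⟩ := cross_of_mem_side hABC hBCD hCDA hDAB hpm
  obtain ⟨q2, q3, q4, q1⟩ := cross_of_mem_side hBCD hCDA hDAB hABC hqm
  obtain ⟨r3, r4, r1, r2⟩ := cross_of_mem_side hCDA hDAB hABC hBCD hrm
  obtain ⟨s4, s1, s2, s3⟩ := cross_of_mem_side hDAB hABC hBCD hCDA hsm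
  let I : Set (ℝ × ℝ) := {z | 0 < cross A B z ∧ 0 < cross B C z ∧ 0 < cross C D z ∧
    0 < cross D A z}
  have hxI : x ∈ I := cross_pos_of_mem_diagonal hABC hCDA hxm
  have hyI : y ∈ I := by
    obtain ⟨h1, h2, h3, h4⟩ := cross_pos_of_mem_diagonal hBCD hDAB hym
    exact ⟨h4, h1, h2, h3⟩
  have hpq : p ≠ q := by rintro rfl; linarith
  have hpr : p ≠ r := by rintro rfl; linarith
  have hps : p ≠ s := by rintro rfl; linarith
  have hqr : q ≠ r := by rintro rfl; linarith
  have hqs : q ≠ s := by rintro rfl; linarith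
  have hrs : r ≠ s := by rintro rfl; linarith
  have hnI : ∀ z ∈ I, p ≠ z ∧ q ≠ z ∧ r ≠ z ∧ s ≠ z := by
    rintro z ⟨h1, h2, h3, h4⟩
    refine ⟨?_, ?_, ?_, ?_⟩ <;> rintro rfl <;> linarith
  have hIblock : ∀ z ∈ I, ∀ v ∈ Q, z ∈ Q → z ≠ v → c z = c v →
      ∃ w ∈ Q, w ∈ I ∧ c w ≠ c z ∧ w ∈ openSegment ℝ z v := by
    intro z hzI v hv hz hzv h
    obtain ⟨w, hw, hwm⟩ := hcQ.exists_blocker hz hv hzv h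
    obtain ⟨z1, z2, z3, z4⟩ := hzI
    obtain ⟨v1, v2, v3, v4⟩ := hv.2.1
    exact ⟨w, hw, ⟨cross_pos_of_mem_openSegment hwm z1.le v1 (Or.inl z1),
      cross_pos_of_mem_openSegment hwm z2.le v2 (Or.inl z2),
      cross_pos_of_mem_openSegment hwm z3.le v3 (Or.inl z3),
      cross_pos_of_mem_openSegment hwm z4.le v4 (Or.inl z4)⟩,
      hcQ.ne_of_mem_openSegment hQ hz hv hw hzv hwm, hwm⟩
  have hI2 : ∀ y ∈ Q, ∀ z ∈ Q, y ∈ I → z ∈ I → y ≠ z → ∀ w ∈ Q, w ∈ I → w = y ∨ w = z := by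
    intro y hy z hz hyI hzI hyz w hw hwI
    by_contra! hne
    obtain ⟨y1, y2, y3, y4⟩ := hnI y hyI
    obtain ⟨z1, z2, z3, z4⟩ := hnI z hzI
    obtain ⟨w1, w2, w3, w4⟩ := hnI w hwI
    have := hcQ.length_le_of_nodup hQ hi (l := [p, q, r, s, y, z, w])
      (by simp [*, hne.1.symm, hne.2.symm]) (by simp [hp, hq, hr, hs, hy, hz, hw])
      (C := Finset.univ \ {i}) (by simp [hi p hp, hi q hq, hi r hr, hi s hs, hi y hy,
        hi z hz, hi w hw])
    have hcard : ∀ j : Fin 4, (Finset.univ \ {j}).card = 3 := by decide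
    rw [hcard] at this
    simp at this
  have hmate : ∀ y ∈ Q, ∀ z ∈ Q, y ∈ I → z ∈ I → y ≠ z →
      c y ≠ c z ∧ ∃ v ∈ Q, c v = c y ∧ z ∈ openSegment ℝ y v := by
    intro y hy z hz hyI hzI hyz
    have hcyz : c y ≠ c z := by
      intro h
      obtain ⟨w, hw, hwI, hcw, -⟩ := hIblock y hyI z hz hy hyz h
      rcases hI2 y hy z hz hyI hzI hyz w hw hwI with rfl | rfl
      · exact hcw rfl
      · exact hcw h.symm
    refine ⟨hcyz, ?_⟩
    obtain ⟨y1, y2, y3, y4⟩ := hnI y hyI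
    obtain ⟨z1, z2, z3, z4⟩ := hnI z hzI
    obtain ⟨v, hv, hyv, hcv⟩ : ∃ v ∈ Q, y ≠ v ∧ c v = c y := by
      by_contra! hne
      have := hcQ.length_le_of_nodup hQ hi (l := [p, q, r, s, z])
        (by simp [*]) (by simp [hp, hq, hr, hs, hz])
        (C := Finset.univ \ {i, c y}) (by simp [hi p hp, hi q hq, hi r hr, hi s hs, hi z hz,
          hne p hp y1.symm, hne q hq y2.symm, hne r hr y3.symm, hne s hs y4.symm, hcyz.symm])
      have hcard : ∀ j k : Fin 4, k ≠ j → (Finset.univ \ {j, k}).card = 2 := by decide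
      rw [hcard _ _ (hi y hy)] at this
      simp at this
    obtain ⟨w, hw, hwI, hcw, hwm⟩ := hIblock y hyI v hv hy hyv hcv.symm
    rcases hI2 y hy z hz hyI hzI hyz w hw hwI with rfl | rfl
    · exact absurd rfl hcw
    · exact ⟨v, hv, hcv, hwm⟩
  have hIuniq : ∀ y ∈ Q, ∀ z ∈ Q, y ∈ I → z ∈ I → y = z := by
    intro y hy z hz hyI hzI
    by_contra hyz
    obtain ⟨hcyz, v, hv, hcv, hm1⟩ := hmate y hy z hz hyI hzI hyz
    obtain ⟨-, w, hw, hcw, hm2⟩ := hmate z hz y hy hzI hyI (Ne.symm hyz)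
    have hyv : y ≠ v := by rintro rfl; simp at hm1; exact hyz hm1.symm
    have hzw : z ≠ w := by rintro rfl; simp at hm2; exact hyz hm2
    have e1 := cross_eq_zero_of_mem_openSegment hm1
    have e2 := cross_eq_zero_of_mem_openSegment hm2
    refine hcQ.not_four_collinear hQ hy hz hv hw hyz hyv ?_ ?_ hzw ?_
      (by rw [cross_rotate v y z, cross_swap, e1, neg_zero]) ((cross_rotate y z w).symm.trans e2)
    all_goals rintro rfl; grind
  obtain rfl : x = y := hIuniq x hx y hy hxI hyI
  have hQall : ∀ w ∈ Q, w = p ∨ w = q ∨ w = r ∨ w = s ∨ w = x := by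
    have hside : ∀ u ∈ K, ∀ v ∈ K, u ≠ v → ∀ z ∈ Q, z ∈ openSegment ℝ u v → ∀ w ∈ Q,
        cross u v w = 0 → w = z := by
      intro u hu v hv huv z hz hzm w hw hw0
      by_contra hwz
      have hne : ∀ t ∈ K, ∀ w ∈ Q, t ≠ w := by
        rintro t ht w hw rfl
        exact hi t hw (hKc t ht)
      exact hc.cross_ne_zero_of_blocker hP (hKP u hu) (hKP v hv) (hQP hz) (hQP hw) huv
        (hne u hu w hw) (hne v hv w hw) (Ne.symm hwz) hzm hw0
    intro w hw
    obtain ⟨-, ⟨w1, w2, w3, w4⟩, -⟩ := id hw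
    rcases w1.eq_or_lt with h1 | h1
    · exact Or.inl (hside A hA B hB hAB p hp hpm w hw h1.symm)
    rcases w2.eq_or_lt with h2 | h2
    · exact Or.inr (Or.inl (hside B hB C hC hBC q hq hqm w hw h2.symm))
    rcases w3.eq_or_lt with h3 | h3
    · exact Or.inr (Or.inr (Or.inl (hside C hC D hD hCD r hr hrm w hw h3.symm)))
    rcases w4.eq_or_lt with h4 | h4
    · exact Or.inr (Or.inr (Or.inr (Or.inl (hside D hD A hA hDA s hs hsm w hw h4.symm))))
    exact Or.inr (Or.inr (Or.inr (Or.inr (hIuniq w hw x hx ⟨h1, h2, h3, h4⟩ hxI))))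
  have hcx : ∀ v ∈ Q, v ≠ x → c v ≠ c x := by
    intro v hv hvx h
    obtain ⟨w, hw, hwI, hcw, -⟩ := hIblock x hxI v hv hx hvx.symm h.symm
    exact hcw (by rw [hIuniq w hw x hx hwI hxI])
  have hmid : ∀ u ∈ Q, ∀ v ∈ Q, u ≠ v → c u = c v →
      (0 < cross A B u ∨ 0 < cross A B v) → (0 < cross B C u ∨ 0 < cross B C v) →
      (0 < cross C D u ∨ 0 < cross C D v) → (0 < cross D A u ∨ 0 < cross D A v) →
      x ∈ openSegment ℝ u v := by
    intro u hu v hv huv h h1 h2 h3 h4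
    obtain ⟨w, hw, hwm⟩ := hcQ.exists_blocker hu hv huv h
    obtain ⟨-, ⟨u1, u2, u3, u4⟩, -⟩ := hu
    obtain ⟨-, ⟨v1, v2, v3, v4⟩, -⟩ := hv
    have hwI : w ∈ I := ⟨cross_pos_of_mem_openSegment hwm u1 v1 h1,
      cross_pos_of_mem_openSegment hwm u2 v2 h2, cross_pos_of_mem_openSegment hwm u3 v3 h3,
      cross_pos_of_mem_openSegment hwm u4 v4 h4⟩
    rwa [← hIuniq w hw x hx hwI hxI]
  obtain ⟨px, qx, rx, sx⟩ := hnI x hxI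
  have cpq : c p ≠ c q := fun h => diagonal_not_mem_openSegment hABC hpm hqm hxm
    (hmid p hp q hq hpq h (Or.inr q1) (Or.inl p2) (Or.inl p3) (Or.inl p4))
  have cqr : c q ≠ c r := fun h => diagonal_not_mem_openSegment hBCD hqm hrm hym
    (hmid q hq r hr hqr h (Or.inl q1) (Or.inr r2) (Or.inl q3) (Or.inl q4))
  have crs : c r ≠ c s := fun h => diagonal_not_mem_openSegment hCDA hrm hsm
    (openSegment_symm ℝ A C ▸ hxm)
    (hmid r hr s hs hrs h (Or.inl r1) (Or.inl r2) (Or.inr s3) (Or.inl r4))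
  have cps : c s ≠ c p := fun h => diagonal_not_mem_openSegment hDAB hsm hpm
    (openSegment_symm ℝ B D ▸ hym)
    (hmid s hs p hp hps.symm h (Or.inl s1) (Or.inl s2) (Or.inl s3) (Or.inr p4))
  have ip := hi p hp; have iq := hi q hq; have ir := hi r hr; have is := hi s hs
  have ix := hi x hx
  have xp := hcx p hp px; have xq := hcx q hq qx; have xr := hcx r hr rx
  have xs := hcx s hs sx
  have cpr : c p = c r := by grind
  have cqs : c q = c s := by grind
  have cA := hKc A hA
  refine ⟨A, B, C, D, p, q, r, s, x, hKe, ?_, hABC, hBCD, hCDA, hDAB, hpm, hqm, hrm, hsm, hxm, hym,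
    hmid p hp r hr hpr cpr (Or.inr r1) (Or.inl p2) (Or.inl p3) (Or.inl p4),
    hmid q hq s hs hqs cqs (Or.inl q1) (Or.inr s2) (Or.inl q3) (Or.inl q4), ?_,
    cA.trans (hKc B hB).symm, (hKc B hB).trans (hKc C hC).symm,
    (hKc C hC).trans (hKc D hD).symm, cpr, cqs, cA.trans_ne ip.symm, cA.trans_ne iq.symm,
    cA.trans_ne ix.symm, cpq, xp, xq⟩
  · simp only [Set.insert_subset_iff, Set.singleton_subset_iff]
    exact ⟨hKP A hA, hKP B hB, hKP C hC, hKP D hD, hQP hp, hQP hq, hQP hr, hQP hs, hQP hx⟩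
  · rintro z ⟨hz, hzR⟩
    by_cases h : c z = i
    · have := hempty ⟨⟨hz, h⟩, hRK hzR⟩
      rw [hKe] at this
      rcases this with rfl | rfl | rfl | rfl <;> simp
    · rcases hQall z ⟨hz, hzR, h⟩ with rfl | rfl | rfl | rfl | rfl <;> simp

namespace BlockedQuad

variable {P : Set (ℝ × ℝ)} {c : ℝ × ℝ → Fin 4} {A B C D p q r s x : ℝ × ℝ}

theorem rotate (h : BlockedQuad P c A B C D p q r s x) :
    BlockedQuad P c B C D A q r s p x where
  subset := fun _ hz => h.subset (by simp only [Set.mem_insert_iff] at hz ⊢; tauto)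
  crossA := h.crossB
  crossB := h.crossC
  crossC := h.crossD
  crossD := h.crossA
  memp := h.memq
  memq := h.memr
  memr := h.mems
  mems := h.memp
  memAC := h.memBD
  memBD := openSegment_symm ℝ A C ▸ h.memAC
  mempr := h.memqs
  memqs := openSegment_symm ℝ p r ▸ h.mempr
  inside := by
    rw [quadRegion_rotate]
    intro z hz
    have := h.inside hz
    simp only [Set.mem_insert_iff] at this ⊢
    tauto
  colAB := h.colBC
  colBC := h.colCD
  colCD := (h.colAB.trans (h.colBC.trans h.colCD)).symm
  colpr := h.colqs
  colqs := h.colpr.symm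
  colAp := h.colAB ▸ h.colAq
  colAq := h.colAB ▸ h.colpr ▸ h.colAp
  colAx := h.colAB ▸ h.colAx
  colpq := h.colpr ▸ h.colpq.symm
  colpx := h.colqx
  colqx := h.colpr ▸ h.colpx

theorem subset_quadRegion (h : BlockedQuad P c A B C D p q r s x) :
    {A, B, C, D, p, q, r, s, x} ⊆ quadRegion A B C D := by
  have hV := vertices_subset_quadRegion h.crossA h.crossB h.crossC h.crossD
  have hR := convex_quadRegion A B C D
  have hA : A ∈ quadRegion A B C D := hV (by simp)
  have hB : B ∈ quadRegion A B C D := hV (by simp)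
  have hC : C ∈ quadRegion A B C D := hV (by simp)
  have hD : D ∈ quadRegion A B C D := hV (by simp)
  simp only [Set.insert_subset_iff, Set.singleton_subset_iff]
  exact ⟨hA, hB, hC, hD, hR.openSegment_subset hA hB h.memp, hR.openSegment_subset hB hC h.memq,
    hR.openSegment_subset hC hD h.memr, hR.openSegment_subset hD hA h.mems,
    hR.openSegment_subset hA hC h.memAC⟩

theorem cross_nonneg (h : BlockedQuad P c A B C D p q r s x) (hP : P.Finite)
    (hc : BlockedColouring P c) {e : ℝ × ℝ} (he : e ∈ P)
    (hblock : ∀ v ∈ P ∩ quadRegion A B C D, ∀ z ∈ P, z ∈ openSegment ℝ e v →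
      z ∈ quadRegion A B C D) : 0 ≤ cross A B e := by
  by_contra! he1
  have hsub : {A, B, C, D, p, q, r, s, x} ⊆ P ∩ quadRegion A B C D :=
    Set.subset_inter h.subset h.subset_quadRegion
  simp only [Set.insert_subset_iff, Set.singleton_subset_iff] at hsub
  obtain ⟨hA, hB, hC, hD, hp, hq, hr, hs, hx⟩ := hsub
  have heR : ∀ v ∈ P ∩ quadRegion A B C D, e ≠ v := by
    rintro v hv rfl
    exact he1.not_ge hv.2.1
  have hblock' : ∀ v ∈ P ∩ quadRegion A B C D, c e = c v →
      ∃ z ∈ P ∩ quadRegion A B C D, z ∈ openSegment ℝ e v ∧ c z ≠ c e := by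
    intro v hv hev
    obtain ⟨z, hz, hzm⟩ := hc.exists_blocker he hv.1 (heR v hv) hev
    exact ⟨z, ⟨hz, hblock v hv z hz hzm⟩, hzm,
      hc.ne_of_mem_openSegment hP he hv.1 hz (heR v hv) hzm⟩
  have beyond : ∀ u w, (∀ z ∈ quadRegion A B C D, 0 ≤ cross u w z) → cross u w e < 0 →
      ∀ v ∈ P ∩ quadRegion A B C D, cross u w v = 0 → c e ≠ c v := by
    intro u w hR hneg v hv hv0 hev
    obtain ⟨z, hz, hzm, -⟩ := hblock' v hv hev
    exact (cross_neg_of_mem_openSegment hzm hneg hv0.le).not_ge (hR z hz.2)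
  obtain ⟨p1, p2, p3, p4⟩ := cross_of_mem_side h.crossA h.crossB h.crossC h.crossD h.memp
  obtain ⟨q2, q3, q4, q1⟩ := cross_of_mem_side h.crossB h.crossC h.crossD h.crossA h.memq
  obtain ⟨r3, r4, r1, r2⟩ := cross_of_mem_side h.crossC h.crossD h.crossA h.crossB h.memr
  obtain ⟨s4, s1, s2, s3⟩ := cross_of_mem_side h.crossD h.crossA h.crossB h.crossC h.mems
  obtain ⟨x1, x2, x3, x4⟩ := cross_pos_of_mem_diagonal h.crossA h.crossC h.memAC
  have hAe := beyond A B (fun z hz => hz.1) he1 A hA (by simp)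
  have hpe := beyond A B (fun z hz => hz.1) he1 p hp p1
  have hcol : c e = c x ∨ c e = c q := by
    have := h.colAp; have := h.colAq; have := h.colAx; have := h.colpq; have := h.colpx
    have := h.colqx
    grind
  have hline : ∀ m ∈ P ∩ quadRegion A B C D, ∀ n ∈ P ∩ quadRegion A B C D,
      ∀ z ∈ P ∩ quadRegion A B C D, m ≠ n → z ∈ openSegment ℝ m n → cross m n e ≠ 0 :=
    fun m hm n hn z hz hmn hzm => hc.cross_ne_zero_of_blocker hP hm.1 hn.1 hz.1 he hmn
      (heR m hm).symm (heR n hn).symm (heR z hz).symm hzm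
  have hthrough : ∀ m ∈ P ∩ quadRegion A B C D, ∀ n ∈ P ∩ quadRegion A B C D,
      ∀ z ∈ P ∩ quadRegion A B C D, m ≠ n → z ∈ openSegment ℝ m n →
        m ∉ openSegment ℝ e z := by
    intro m hm n hn z hz hmn hzm hme
    have hmz := ((mem_openSegment_iff_sbtw hmn).1 hzm).left_ne
    exact hline m hm n hn z hz hmn hzm (cross_eq_zero_trans hmz
      (cross_eq_zero_of_mem_openSegment' hzm) (by
        rw [cross_rotate, cross_eq_zero_of_mem_openSegment' hme]))
  have hnear : ∀ m ∈ P ∩ quadRegion A B C D, ∀ n ∈ P ∩ quadRegion A B C D,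
      ∀ z ∈ P ∩ quadRegion A B C D, m ≠ n → z ∈ openSegment ℝ m n →
        z ∉ openSegment ℝ e m := by
    intro m hm n hn z hz hmn hzm hze
    have hmz := ((mem_openSegment_iff_sbtw hmn).1 hzm).left_ne
    exact hline m hm n hn z hz hmn hzm (cross_eq_zero_trans hmz
      (cross_eq_zero_of_mem_openSegment' hzm)
      (by rw [cross_rotate, cross_eq_zero_of_mem_openSegment hze]))
  have hAC : A ≠ C := by rintro rfl; simpa using h.crossA
  have hBD : B ≠ D := by rintro rfl; simpa using h.crossB
  have hpr : p ≠ r := by rintro rfl; linarith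
  have hqs : q ≠ s := by rintro rfl; linarith
  rcases hcol with hcol | hcol
  · obtain ⟨z, hz, hzm, hcz⟩ := hblock' x hx hcol
    rcases h.inside hz with rfl | rfl | rfl | rfl | rfl | rfl | rfl | rfl | rfl
    · exact hthrough _ hA _ hC _ hx hAC h.memAC hzm
    · exact hthrough _ hB _ hD _ hx hBD h.memBD hzm
    · exact hthrough _ hC _ hA _ hx hAC.symm (openSegment_symm ℝ A z ▸ h.memAC) hzm
    · exact hthrough _ hD _ hB _ hx hBD.symm (openSegment_symm ℝ B z ▸ h.memBD) hzm
    · exact hthrough _ hp _ hr _ hx hpr h.mempr hzm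
    · exact hthrough _ hq _ hs _ hx hqs h.memqs hzm
    · exact hthrough _ hr _ hp _ hx hpr.symm (openSegment_symm ℝ p z ▸ h.mempr) hzm
    · exact hthrough _ hs _ hq _ hx hqs.symm (openSegment_symm ℝ q z ▸ h.memqs) hzm
    · exact hcz hcol.symm
  · have e2 : 0 < cross B C e := by
      rcases lt_trichotomy (cross B C e) 0 with h0 | h0 | h0
      · exact absurd hcol (beyond B C (fun z hz => hz.2.1) h0 q hq q2)
      · have hBC : B ≠ C := by rintro rfl; simpa using h.crossA
        exact absurd h0 (hline B hB C hC q hq hBC h.memq)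
      · exact h0
    have e4 : 0 < cross D A e := by
      rcases lt_trichotomy (cross D A e) 0 with h0 | h0 | h0
      · exact absurd (hcol.trans h.colqs) (beyond D A (fun z hz => hz.2.2.2) h0 s hs s4)
      · have hDA : D ≠ A := by rintro rfl; simpa using h.crossC
        exact absurd h0 (hline D hD A hA s hs hDA h.mems)
      · exact h0
    have hpr_of : ∀ z ∈ P ∩ quadRegion A B C D, 0 < cross B C z → 0 < cross D A z → z ≠ x →
        z = p ∨ z = r := by
      intro z hz z2 z4 hzx
      rcases h.inside hz with hE | hE | hE | hE | hE | hE | hE | hE | hE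
      · simp [hE] at z4
      · simp [hE] at z2
      · simp [hE] at z2
      · simp [hE] at z4
      · exact Or.inl hE
      · exact absurd z2 (by rw [hE, q2]; exact lt_irrefl 0)
      · exact Or.inr hE
      · exact absurd z4 (by rw [hE, s4]; exact lt_irrefl 0)
      · exact absurd hE hzx
    obtain ⟨y, hy, hym, -⟩ := hblock' q hq hcol
    obtain ⟨z, hz, hzm, -⟩ := hblock' s hs (hcol.trans h.colqs)
    have hyx : y ≠ x := by
      rintro rfl
      exact hnear q hq s hs _ hx hqs h.memqs hym
    have hzx : z ≠ x := by
      rintro rfl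
      exact hnear s hs q hq _ hx hqs.symm (openSegment_symm ℝ q s ▸ h.memqs) hzm
    have hy' := hpr_of y hy (cross_pos_of_mem_openSegment hym e2.le q2.ge (Or.inl e2))
      (cross_pos_of_mem_openSegment hym e4.le q4.le (Or.inl e4)) hyx
    have hz' := hpr_of z hz (cross_pos_of_mem_openSegment hzm e2.le s2.le (Or.inl e2))
      (cross_pos_of_mem_openSegment hzm e4.le s4.ge (Or.inl e4)) hzx
    have hyz : y ≠ z := by
      rintro rfl
      refine hline _ hq _ hs _ hx hqs h.memqs ?_
      rw [← cross_rotate, ← cross_rotate]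
      exact cross_eq_zero_trans (heR _ hy) (cross_eq_zero_of_mem_openSegment' hym)
        (cross_eq_zero_of_mem_openSegment' hzm)
    have hxyz : x ∈ openSegment ℝ y z := by
      have := openSegment_symm ℝ p r ▸ h.mempr
      rcases hy' with rfl | rfl <;> rcases hz' with rfl | rfl
      exacts [absurd rfl hyz, h.mempr, this, absurd rfl hyz]
    obtain ⟨a₁, b₁, ha₁, hb₁, -, Y⟩ := exists_cross_of_mem_openSegment hym
    obtain ⟨a₂, b₂, ha₂, hb₂, -, Z⟩ := exists_cross_of_mem_openSegment hzm
    obtain ⟨a₃, b₃, ha₃, hb₃, -, X⟩ := exists_cross_of_mem_openSegment hxyz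
    have h0 := cross_eq_zero_of_mem_openSegment h.memqs
    rw [X, Y, Z, cross_self_left, cross_self_right] at h0
    have h1 : (a₃ * a₁ + b₃ * a₂) * cross q s e = 0 := by linear_combination h0
    exact mul_ne_zero (by positivity) (hline q hq s hs x hx hqs h.memqs) h1

theorem subset_quadRegion_of_blockedColouring (h : BlockedQuad P c A B C D p q r s x)
    (hP : P.Finite) (hc : BlockedColouring P c) : P ⊆ quadRegion A B C D := by
  by_contra hne
  let G : ℝ × ℝ → ℝ := fun z =>
    max (max (-cross A B z) (-cross B C z)) (max (-cross C D z) (-cross D A z))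
  have hG : ∀ z, z ∈ quadRegion A B C D ↔ G z ≤ 0 := by
    intro z
    simp only [G, quadRegion, Set.mem_ofPred_eq, max_le_iff, neg_nonpos]
    tauto
  obtain ⟨e, he, hmin⟩ := (P \ quadRegion A B C D).exists_min_image G hP.sdiff
    (Set.not_subset.1 hne)
  have hblock : ∀ v ∈ P ∩ quadRegion A B C D, ∀ z ∈ P, z ∈ openSegment ℝ e v →
      z ∈ quadRegion A B C D := by
    rintro v ⟨-, v1, v2, v3, v4⟩ z hz hzm
    by_contra hzR
    have hle := hmin z ⟨hz, hzR⟩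
    have hpos : 0 < G e := not_le.1 fun h0 => he.2 ((hG e).2 h0)
    refine hle.not_gt ?_
    obtain ⟨a, b, ha, hb, hab, Z⟩ := exists_cross_of_mem_openSegment hzm
    have key : ∀ u w, 0 ≤ cross u w v → -cross u w e ≤ G e → -cross u w z < G e := by
      intro u w h1 h2
      rw [Z]
      nlinarith [mul_nonneg hb.le h1, mul_le_mul_of_nonneg_left h2 ha.le]
    exact max_lt (max_lt (key A B v1 (by simp [G])) (key B C v2 (by simp [G])))
      (max_lt (key C D v3 (by simp [G])) (key D A v4 (by simp [G])))
  have hB := h.rotate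
  have hC := hB.rotate
  have hD := hC.rotate
  have RB := quadRegion_rotate A B C D
  have RC := (quadRegion_rotate B C D A).trans RB
  have RD := (quadRegion_rotate C D A B).trans RC
  exact he.2 ⟨h.cross_nonneg hP hc he.1 hblock, hB.cross_nonneg hP hc he.1 (by rwa [RB]),
    hC.cross_nonneg hP hc he.1 (by rwa [RC]), hD.cross_nonneg hP hc he.1 (by rwa [RD])⟩

theorem isNBlocked (h : BlockedQuad P c A B C D p q r s x)
    (hP : P.Finite) (hc : BlockedColouring P c)
    (hcard : ({A, B, C, D} : Set (ℝ × ℝ)).ncard = 4) : IsNBlocked {4, 2, 2, 1} P := by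
  have hPe : P = {A, B, C, D, p, q, r, s, x} :=
    Set.Subset.antisymm
      (fun z hz => h.inside ⟨hz, h.subset_quadRegion_of_blockedColouring hP hc hz⟩) h.subset
  have colAB := h.colAB; have colBC := h.colBC; have colCD := h.colCD
  have colpr := h.colpr; have colqs := h.colqs
  have colAp := h.colAp; have colAq := h.colAq; have colAx := h.colAx
  have colpq := h.colpq; have colpx := h.colpx; have colqx := h.colqx
  have hpr : p ≠ r := by
    rintro rfl
    have := h.mempr
    rw [openSegment_same, Set.mem_singleton_iff] at this
    exact h.colpx (by rw [this])
  have hqs : q ≠ s := by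
    rintro rfl
    have := h.memqs
    rw [openSegment_same, Set.mem_singleton_iff] at this
    exact h.colqx (by rw [this])
  have hA : P ∩ c ⁻¹' {c A} = {A, B, C, D} := by
    ext z
    simp only [hPe, Set.mem_inter_iff, Set.mem_insert_iff, Set.mem_singleton_iff,
      Set.mem_preimage]
    grind
  have hp : P ∩ c ⁻¹' {c p} = {p, r} := by
    ext z
    simp only [hPe, Set.mem_inter_iff, Set.mem_insert_iff, Set.mem_singleton_iff,
      Set.mem_preimage]
    grind
  have hq : P ∩ c ⁻¹' {c q} = {q, s} := by
    ext z
    simp only [hPe, Set.mem_inter_iff, Set.mem_insert_iff, Set.mem_singleton_iff,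
      Set.mem_preimage]
    grind
  have hx : P ∩ c ⁻¹' {c x} = {x} := by
    ext z
    simp only [hPe, Set.mem_inter_iff, Set.mem_insert_iff, Set.mem_singleton_iff,
      Set.mem_preimage]
    grind
  have huniv : (Finset.univ : Finset (Fin 4)).val = {c A, c p, c q, c x} := by
    generalize c A = i at *; generalize c p = j at *; generalize c q = k at *
    generalize c x = l at *
    clear * - colAp colAq colAx colpq colpx colqx
    revert i j k l
    decide
  refine ⟨hP, 4, c, hc, ?_⟩
  rw [huniv]
  simp [hA, hp, hq, hx, hcard, Set.ncard_pair hpr, Set.ncard_pair hqs]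

end BlockedQuad

end BlockedQuad

end Quadrilateral

/-- If a colour class `S` of a 4-blocked set `P` contains a 4-point subset `K` in
convex position whose convex hull contains no other point of `S`, then `P` is
`{4,2,2,1}`-blocked. -/
theorem empty_quadrilateral_4221 (P : Set (ℝ × ℝ)) (hfin : P.Finite)
    (c : (ℝ × ℝ) → Fin 4) (hc : BlockedColouring P c)
    (i : Fin 4) (K : Set (ℝ × ℝ)) (hKS : K ⊆ P ∩ c ⁻¹' {i})
    (hK4 : K.ncard = 4) (hKconv : ConvexPosition K)
    (hempty : (P ∩ c ⁻¹' {i}) ∩ convexHull ℝ K ⊆ K) :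
    IsNBlocked ({4, 2, 2, 1} : Multiset ℕ) P := by
  obtain ⟨A, B, C, D, p, q, r, s, x, rfl, h⟩ := exists_blockedQuad hfin hc hKS hK4 hKconv hempty
  exact h.isNBlocked hfin hc hK4
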